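/- Let λ > 1 and set β = λ. Then there exists h > 0 such that f_{λ,λ}(h) = h and the pair (λ, λ²·h) satisfies the AT condition. -/

import Mathlib

open MeasureTheory ProbabilityTheory

noncomputable section

/-- Standard Gaussian measure on `ℝ`. -/
def stdGaussian : Measure ℝ := gaussianReal 0 1

/-- The overlap constant `q_{β,h}`, the unique solution in `(0,1]` of the replica-symmetric
fixed point equation (set to `0` for `h = 0`). -/
def qOverlap (β h : ℝ) : ℝ :=
  if h = 0 then 0 else
    sSup {q : ℝ | q ∈ Set.Ioc (0 : ℝ) 1 ∧
      q = ∫ g, Real.tanh (β * g * Real.sqrt q + h) ^ 2 ∂stdGaussian}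

/-- `q₁(β,h) = E tanh(β g √q_{β,h} + h)`. -/
def q1 (β h : ℝ) : ℝ :=
  ∫ g, Real.tanh (β * g * Real.sqrt (qOverlap β h) + h) ∂stdGaussian

/-- Hyperbolic secant. -/
def sech (x : ℝ) : ℝ := 1 / Real.cosh x

/-- The Almeida–Thouless condition for `(β,h)`. -/
def ATCond (β h : ℝ) : Prop :=
  β ^ 2 * ∫ g, sech (β * g * Real.sqrt (qOverlap β h) + h) ^ 4 ∂stdGaussian < 1

/-- The AT condition with gap at least `g0`. -/
def ATgap (β h g0 : ℝ) : Prop :=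
  β ^ 2 * ∫ g, sech (β * g * Real.sqrt (qOverlap β h) + h) ^ 4 ∂stdGaussian ≤ 1 - g0

/-- The one-dimensional RGD/AMP update map `f_{β,λ}`. -/
def fbl (β lam z : ℝ) : ℝ :=
  ∫ g, Real.tanh (β * g * Real.sqrt (qOverlap β (β * lam * z)) + β * lam * z) ∂stdGaussian

/-- `h_* = inf{h ≥ 0 : (β,h) satisfies AT}`. -/
def hStar (β : ℝ) : ℝ := sInf {h : ℝ | 0 ≤ h ∧ ATCond β h}

lemma sg_tilt (u : ℝ → ℝ) (t : ℝ) :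
    ∫ g, u (g + t) ∂stdGaussian = ∫ g, u g * Real.exp (t * g - t ^ 2 / 2) ∂stdGaussian := by
  unfold _root_.stdGaussian
  rw [integral_gaussianReal_eq_integral_smul one_ne_zero,
    integral_gaussianReal_eq_integral_smul one_ne_zero]
  symm
  rw [← integral_add_right_eq_self _ t]
  congr 1
  ext x
  simp only [gaussianPDFReal_def, smul_eq_mul, NNReal.coe_one, mul_one, sub_zero]
  rw [show -x ^ 2 / 2 = -(x + t) ^ 2 / 2 + (t * (x + t) - t ^ 2 / 2) by ring, Real.exp_add]
  ring

lemma sg_neg (u : ℝ → ℝ) :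
    ∫ g, u (-g) ∂stdGaussian = ∫ g, u g ∂stdGaussian := by
  unfold _root_.stdGaussian
  rw [integral_gaussianReal_eq_integral_smul one_ne_zero,
    integral_gaussianReal_eq_integral_smul one_ne_zero,
    ← integral_neg_eq_self]
  congr 1
  ext x
  simp [gaussianPDFReal_def]

instance : IsProbabilityMeasure stdGaussian := by unfold _root_.stdGaussian; infer_instance

lemma sg_int_exp (t : ℝ) : Integrable (fun g => Real.exp (t * g)) stdGaussian := by
  unfold _root_.stdGaussian
  exact integrable_exp_mul_gaussianReal t

lemma sg_int_id : Integrable (fun g : ℝ => g) stdGaussian := by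
  unfold _root_.stdGaussian
  exact (memLp_id_gaussianReal 1).integrable (by simp)

lemma sg_int_bdd {u : ℝ → ℝ} (hu : Continuous u) {C : ℝ} (hC : ∀ x, |u x| ≤ C) :
    Integrable u stdGaussian :=
  Integrable.of_bound hu.aestronglyMeasurable C (ae_of_all _ hC)

lemma sg_int_bdd_mul {u v : ℝ → ℝ} (hu : Continuous u) {C : ℝ} (hC : ∀ x, |u x| ≤ C)
    (hv : Integrable v stdGaussian) :
    Integrable (fun x => u x * v x) stdGaussian :=
  hv.bdd_mul hu.aestronglyMeasurable (ae_of_all _ hC)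

lemma sg_odd {u : ℝ → ℝ} (h : ∀ x, u (-x) = - u x) : ∫ g, u g ∂stdGaussian = 0 := by
  have := sg_neg u
  simp only [h, integral_neg] at this
  linarith

lemma sg_vol {F : ℝ → ℝ} (h : Integrable F stdGaussian) :
    Integrable (fun x => gaussianPDFReal 0 1 x * F x) := by
  unfold _root_.stdGaussian at h
  rw [gaussianReal_of_var_ne_zero _ one_ne_zero,
    integrable_withDensity_iff_integrable_smul' (measurable_gaussianPDF _ _)
      (ae_of_all _ fun _ ↦ gaussianPDF_lt_top)] at h
  simpa using h

lemma sg_stein {u u' : ℝ → ℝ} (hd : ∀ x, HasDerivAt u (u' x) x) (hu' : Continuous u')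
    {C : ℝ} (hC : ∀ x, |u x| ≤ C) {C' : ℝ} (hC' : ∀ x, |u' x| ≤ C') :
    ∫ g, g * u g ∂stdGaussian = ∫ g, u' g ∂stdGaussian := by
  have hu : Continuous u := continuous_iff_continuousAt.2 fun x => (hd x).continuousAt
  have i1 : Integrable (fun g => g * u g) stdGaussian := by
    simpa [mul_comm] using sg_int_bdd_mul hu hC sg_int_id
  have i2 := sg_int_bdd hu' hC'
  have i3 := sg_int_bdd hu hC
  suffices h : ∫ g, (u' g - g * u g) ∂stdGaussian = 0 by
    rw [integral_sub i2 i1] at h; linarith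
  have i4 := sg_vol (i2.sub i1)
  have i5 := sg_vol i3
  unfold _root_.stdGaussian
  rw [integral_gaussianReal_eq_integral_smul one_ne_zero]
  refine integral_eq_zero_of_hasDerivAt_of_integrable (f := fun x => gaussianPDFReal 0 1 x * u x)
    (fun x => ?_) i4 i5
  have hp : HasDerivAt (gaussianPDFReal 0 1) (gaussianPDFReal 0 1 x * (-x)) x := by
    rw [gaussianPDFReal_def]
    have h1 : HasDerivAt (fun x : ℝ => -(x - 0) ^ 2 / (2 * ((1 : NNReal) : ℝ))) (-x) x := by
      have := (((hasDerivAt_id x).sub_const 0).pow 2).neg.div_const (2 * ((1 : NNReal) : ℝ))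
      exact this.congr_deriv (by simp; ring)
    exact (h1.exp.const_mul _).congr_deriv (by ring)
  exact (hp.mul (hd x)).congr_deriv (by simp only [smul_eq_mul]; ring)

lemma cosh_inv_le (x : ℝ) : (Real.cosh x)⁻¹ ≤ 1 := inv_le_one_of_one_le₀ (Real.one_le_cosh x)
lemma cosh_inv_pos (x : ℝ) : 0 < (Real.cosh x)⁻¹ := inv_pos.2 (Real.cosh_pos x)

lemma cosh_inv_pow_bd (n : ℕ) (x : ℝ) : |(Real.cosh x)⁻¹ ^ n| ≤ 1 := by
  rw [abs_of_pos (pow_pos (cosh_inv_pos x) n)]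
  exact pow_le_one₀ (cosh_inv_pos x).le (cosh_inv_le x)

lemma cosh_inv_cont : Continuous fun x : ℝ => (Real.cosh x)⁻¹ :=
  Real.continuous_cosh.inv₀ fun x => (Real.cosh_pos x).ne'

lemma tanh_cont : Continuous Real.tanh := by
  have : Real.tanh = fun x => Real.sinh x * (Real.cosh x)⁻¹ := by
    ext x; rw [Real.tanh_eq_sinh_div_cosh, div_eq_mul_inv]
  rw [this]
  exact Real.continuous_sinh.mul cosh_inv_cont

lemma tanh_sq_eq (x : ℝ) : Real.tanh x ^ 2 = 1 - (Real.cosh x)⁻¹ ^ 2 := by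
  have := Real.cosh_pos x
  rw [Real.tanh_eq_sinh_div_cosh]
  field_simp
  linarith [Real.cosh_sq x]

lemma sg_nn {u : ℝ → ℝ} (hc : Continuous u) {C : ℝ} (hC : ∀ x, |u x| ≤ C)
    (ho : ∀ x, u (-x) = - u x) (hp : ∀ x, 0 ≤ x → 0 ≤ u x) {m : ℝ} (hm : 0 ≤ m) :
    0 ≤ ∫ g, u (g + m) ∂stdGaussian := by
  have i1 : ∀ t : ℝ, Integrable (fun g => u g * Real.exp (t * g - m ^ 2 / 2)) stdGaussian := by
    intro t
    simp_rw [sub_eq_add_neg, Real.exp_add]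
    exact sg_int_bdd_mul hc hC ((sg_int_exp t).mul_const _)
  have e1 := sg_tilt u m
  have e2 := sg_neg (fun g => u g * Real.exp (m * g - m ^ 2 / 2))
  have e3 : ∫ g, u (-g) * Real.exp (m * -g - m ^ 2 / 2) ∂stdGaussian
      = - ∫ g, u g * Real.exp ((-m) * g - m ^ 2 / 2) ∂stdGaussian := by
    rw [← integral_neg]
    congr 1; ext g
    rw [ho]; ring_nf
  have e4 : 0 ≤ ∫ g, (u g * Real.exp (m * g - m ^ 2 / 2)
      - u g * Real.exp ((-m) * g - m ^ 2 / 2)) ∂stdGaussian := by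
    apply integral_nonneg
    intro g
    simp only [Pi.zero_apply]
    rw [← mul_sub]
    rcases le_total 0 g with hg | hg
    · apply mul_nonneg (hp g hg)
      rw [sub_nonneg]
      apply Real.exp_le_exp.2
      nlinarith [mul_nonneg hm hg]
    · apply mul_nonneg_of_nonpos_of_nonpos
      · have := hp (-g) (by linarith)
        rw [ho] at this; linarith
      · rw [sub_nonpos]
        apply Real.exp_le_exp.2
        nlinarith [mul_nonneg hm (neg_nonneg.2 hg)]
  rw [integral_sub (i1 m) (i1 (-m))] at e4
  linarith

lemma tanh_sq_mono {s a b : ℝ} (hs : 0 < s) (ha : 0 ≤ a) (hab : a ≤ b) :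
    ∫ g, Real.tanh (s * g + a) ^ 2 ∂stdGaussian ≤ ∫ g, Real.tanh (s * g + b) ^ 2 ∂stdGaussian := by
  have cc : ∀ d : ℝ, Continuous fun x => Real.tanh (s * x + d) ^ 2 := fun d =>
    (tanh_cont.comp (by fun_prop)).pow 2
  have bb : ∀ y : ℝ, |Real.tanh y ^ 2| ≤ 1 := fun y => by
    rw [abs_of_nonneg (sq_nonneg _)]; exact (Real.tanh_sq_lt_one y).le
  have key := sg_nn (u := fun x => Real.tanh (s * x + (b - a) / 2) ^ 2
      - Real.tanh (s * x + (-((b - a) / 2))) ^ 2) (C := 2) (m := (a + b) / 2 / s)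
    ((cc _).sub (cc _))
    (fun x => (abs_sub _ _).trans (by linarith [bb (s * x + (b - a) / 2), bb (s * x + (-((b - a) / 2)))]))
    (fun x => by
      rw [show s * -x + (b - a) / 2 = - (s * x + (-((b - a) / 2))) by ring,
        show s * -x + (-((b - a) / 2)) = - (s * x + (b - a) / 2) by ring, Real.tanh_neg,
        Real.tanh_neg]
      ring)
    (fun x hx => by
      rw [tanh_sq_eq, tanh_sq_eq]
      have : Real.cosh (s * x + (-((b - a) / 2))) ≤ Real.cosh (s * x + (b - a) / 2) := by
        rw [Real.cosh_le_cosh]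
        have := mul_nonneg hs.le hx
        rw [abs_of_nonneg (a := s * x + (b - a) / 2) (by linarith)]
        exact abs_le.2 ⟨by linarith, by linarith⟩
      have h2 := inv_anti₀ (Real.cosh_pos _) this
      have h3 := pow_le_pow_left₀ (cosh_inv_pos _).le h2 2
      linarith)
    (div_nonneg (by linarith) hs.le)
  have e : ∀ g : ℝ, s * (g + (a + b) / 2 / s) = s * g + (a + b) / 2 := fun g => by field_simp
  simp only [e] at key
  have e1 : ∀ g : ℝ, s * g + (a + b) / 2 + (b - a) / 2 = s * g + b := fun g => by ring
  have e2 : ∀ g : ℝ, s * g + (a + b) / 2 + -((b - a) / 2) = s * g + a := fun g => by ring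
  simp only [e1, e2] at key
  rw [integral_sub (sg_int_bdd (cc _) fun _ => bb _) (sg_int_bdd (cc _) fun _ => bb _)] at key
  linarith

/-- `KK n s = E sech(s g)^n`. -/
def KK (n : ℕ) (s : ℝ) : ℝ := ∫ g, (Real.cosh (s * g))⁻¹ ^ n ∂_root_.stdGaussian

/-- Derivative profile. -/
def DD (s : ℝ) : ℝ := Real.exp (-s ^ 2 / 2) * KK 3 s

/-- Overlap profile. -/
def SS (s : ℝ) : ℝ := 1 - Real.exp (-s ^ 2 / 2) * KK 1 s

lemma tanh_abs_le (x : ℝ) : |Real.tanh x| ≤ 1 := (Real.abs_tanh_lt_one x).le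

lemma ch_cont (n : ℕ) (s a : ℝ) : Continuous fun g : ℝ => (Real.cosh (s * g + a))⁻¹ ^ n :=
  (cosh_inv_cont.comp (by fun_prop : Continuous fun g : ℝ => s * g + a)).pow n

lemma ch_cont0 (n : ℕ) (s : ℝ) : Continuous fun g : ℝ => (Real.cosh (s * g))⁻¹ ^ n := by
  simpa using ch_cont n s 0

lemma th_cont (s a : ℝ) : Continuous fun g : ℝ => Real.tanh (s * g + a) :=
  tanh_cont.comp (by fun_prop)

lemma th_cont0 (s : ℝ) : Continuous fun g : ℝ => Real.tanh (s * g) := by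
  simpa using th_cont s 0

lemma KK_int (n : ℕ) (s : ℝ) :
    Integrable (fun g : ℝ => (Real.cosh (s * g))⁻¹ ^ n) _root_.stdGaussian :=
  sg_int_bdd (ch_cont0 n s) fun _ => cosh_inv_pow_bd n _

lemma thch_bd (n : ℕ) (y : ℝ) : |Real.tanh y * (Real.cosh y)⁻¹ ^ n| ≤ 1 := by
  rw [abs_mul]
  exact mul_le_one₀ (tanh_abs_le _) (abs_nonneg _) (cosh_inv_pow_bd n _)

lemma thch_odd (n : ℕ) (s : ℝ) :
    ∫ g, Real.tanh (s * g) * (Real.cosh (s * g))⁻¹ ^ n ∂_root_.stdGaussian = 0 := by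
  apply sg_odd (u := fun g => Real.tanh (s * g) * (Real.cosh (s * g))⁻¹ ^ n)
  intro x
  rw [mul_neg, Real.tanh_neg, Real.cosh_neg]; ring

lemma exp_eq_cosh (y : ℝ) : Real.exp y = Real.cosh y * (1 + Real.tanh y) := by
  have := (Real.cosh_pos y).ne'
  rw [Real.tanh_eq_sinh_div_cosh]
  field_simp
  rw [Real.cosh_add_sinh]

lemma nish (n : ℕ) (s : ℝ) :
    ∫ g, (Real.cosh (s * g + s ^ 2))⁻¹ ^ (n + 1) ∂_root_.stdGaussian
      = Real.exp (-s ^ 2 / 2) * KK n s := by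
  have h := sg_tilt (fun x => (Real.cosh (s * x))⁻¹ ^ (n + 1)) s
  have e1 : ∀ g : ℝ, s * (g + s) = s * g + s ^ 2 := fun g => by ring
  simp only [e1] at h
  rw [h]
  have e2 : ∀ g : ℝ, (Real.cosh (s * g))⁻¹ ^ (n + 1) * Real.exp (s * g - s ^ 2 / 2)
      = Real.exp (-s ^ 2 / 2) * ((Real.cosh (s * g))⁻¹ ^ n
        + Real.tanh (s * g) * (Real.cosh (s * g))⁻¹ ^ n) := fun g => by
    rw [show s * g - s ^ 2 / 2 = s * g + -s ^ 2 / 2 by ring, Real.exp_add, exp_eq_cosh (s * g),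
      pow_succ]
    have := (Real.cosh_pos (s * g)).ne'
    field_simp
  simp only [e2]
  have i2 : Integrable (fun g => Real.tanh (s * g) * (Real.cosh (s * g))⁻¹ ^ n)
      _root_.stdGaussian :=
    sg_int_bdd ((th_cont0 s).mul (ch_cont0 n s)) fun _ => thch_bd n _
  rw [integral_const_mul, integral_add (KK_int n s) i2, thch_odd, add_zero, KK]

lemma tanh_sq_SS (s : ℝ) :
    ∫ g, Real.tanh (s * g + s ^ 2) ^ 2 ∂_root_.stdGaussian = SS s := by
  simp only [tanh_sq_eq]
  rw [integral_sub (integrable_const _) (sg_int_bdd (ch_cont 2 s _) fun _ => cosh_inv_pow_bd 2 _),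
    nish 1 s]
  simp [SS]

lemma tanh_SS (s : ℝ) :
    ∫ g, Real.tanh (s * g + s ^ 2) ∂_root_.stdGaussian = SS s := by
  rw [← tanh_sq_SS]
  have i1 : Integrable (fun g => Real.tanh (s * g + s ^ 2)) _root_.stdGaussian :=
    sg_int_bdd (th_cont s _) fun _ => tanh_abs_le _
  have i2 : Integrable (fun g => Real.tanh (s * g + s ^ 2) ^ 2) _root_.stdGaussian :=
    sg_int_bdd ((th_cont s _).pow 2) (C := 1) fun _ => by
      rw [abs_of_nonneg (sq_nonneg _)]; exact (Real.tanh_sq_lt_one _).le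
  rw [← sub_eq_zero, ← integral_sub i1 i2]
  have h := sg_tilt (fun x => Real.tanh (s * x) - Real.tanh (s * x) ^ 2) s
  have e1 : ∀ g : ℝ, s * (g + s) = s * g + s ^ 2 := fun g => by ring
  simp only [e1] at h
  rw [h]
  have e2 : ∀ g : ℝ, (Real.tanh (s * g) - Real.tanh (s * g) ^ 2) * Real.exp (s * g - s ^ 2 / 2)
      = Real.exp (-s ^ 2 / 2) * (Real.tanh (s * g) * (Real.cosh (s * g))⁻¹ ^ 1) := fun g => by
    rw [show s * g - s ^ 2 / 2 = s * g + -s ^ 2 / 2 by ring, Real.exp_add, exp_eq_cosh (s * g)]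
    have h3 := tanh_sq_eq (s * g)
    have h4 : Real.cosh (s * g) * (1 - Real.tanh (s * g) ^ 2) = (Real.cosh (s * g))⁻¹ := by
      rw [h3]
      have := (Real.cosh_pos (s * g)).ne'
      field_simp
      ring
    rw [pow_one, ← h4]
    ring
  simp only [e2]
  rw [integral_const_mul, thch_odd, mul_zero]

lemma cosh_inv_deriv (y : ℝ) :
    HasDerivAt (fun y => (Real.cosh y)⁻¹) (-(Real.tanh y * (Real.cosh y)⁻¹)) y := by
  have h := (Real.hasDerivAt_cosh y).inv (Real.cosh_pos y).ne'
  refine h.congr_deriv ?_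
  have := (Real.cosh_pos y).ne'
  rw [Real.tanh_eq_sinh_div_cosh]
  field_simp

lemma thch_deriv (y : ℝ) :
    HasDerivAt (fun y => -(Real.tanh y * (Real.cosh y)⁻¹))
      ((Real.cosh y)⁻¹ ^ 1 - 2 * (Real.cosh y)⁻¹ ^ 3) y := by
  have ht : Real.tanh = fun x => Real.sinh x * (Real.cosh x)⁻¹ := by
    ext x; rw [Real.tanh_eq_sinh_div_cosh, div_eq_mul_inv]
  have h1 := (Real.hasDerivAt_sinh y).mul (cosh_inv_deriv y)
  have h2 := (h1.mul (cosh_inv_deriv y)).neg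
  rw [ht]
  refine h2.congr_deriv ?_
  have := (Real.cosh_pos y).ne'
  simp only [Pi.mul_apply, ht]
  field_simp
  rw [Real.sinh_sq]
  ring

lemma KK_deriv (s : ℝ) : HasDerivAt (KK 1) (s * (KK 1 s - 2 * KK 3 s)) s := by
  have h := (hasDerivAt_integral_of_dominated_loc_of_deriv_le (μ := _root_.stdGaussian)
    (F := fun s g => (Real.cosh (s * g))⁻¹ ^ 1)
    (F' := fun s g => g * -(Real.tanh (s * g) * (Real.cosh (s * g))⁻¹)) (x₀ := s)
    (s := Set.univ) (bound := fun g => |g|) Filter.univ_mem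
    (Filter.Eventually.of_forall fun x => (ch_cont0 1 x).aestronglyMeasurable)
    (KK_int 1 s)
    (by
      have := (th_cont0 s).mul (ch_cont0 1 s)
      simp only [pow_one] at this
      exact (continuous_id.mul this.neg).aestronglyMeasurable)
    (ae_of_all _ fun g x _ => by
      rw [Real.norm_eq_abs, abs_mul, abs_neg]
      have := thch_bd 1 (x * g)
      rw [pow_one] at this
      exact mul_le_of_le_one_right (abs_nonneg _) this)
    sg_int_id.abs
    (ae_of_all _ fun g x _ => by
      simp only [pow_one]
      have := (cosh_inv_deriv (x * g)).comp x ((hasDerivAt_id x).mul_const g)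
      exact this.congr_deriv (by ring))).2
  refine h.congr_deriv ?_
  rw [sg_stein (u := fun g => -(Real.tanh (s * g) * (Real.cosh (s * g))⁻¹))
    (u' := fun g => s * ((Real.cosh (s * g))⁻¹ ^ 1 - 2 * (Real.cosh (s * g))⁻¹ ^ 3))
    (C := 1) (C' := |s| * 3)]
  · rw [integral_const_mul, integral_sub (KK_int 1 s) ((KK_int 3 s).const_mul 2),
      integral_const_mul, KK, KK]
  · intro x
    have := (thch_deriv (s * x)).comp x ((hasDerivAt_id x).const_mul s)
    exact this.congr_deriv (by ring)
  · exact continuous_const.mul ((ch_cont0 1 s).sub (continuous_const.mul (ch_cont0 3 s)))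
  · intro x
    rw [abs_neg]
    simpa using thch_bd 1 (s * x)
  · intro x
    rw [abs_mul]
    apply mul_le_mul_of_nonneg_left _ (abs_nonneg _)
    have h1 := abs_le.1 (cosh_inv_pow_bd 1 (s * x))
    have h3 := abs_le.1 (cosh_inv_pow_bd 3 (s * x))
    exact abs_le.2 ⟨by linarith, by linarith⟩

lemma SS_deriv (s : ℝ) : HasDerivAt SS (DD s * (2 * s)) s := by
  have h1 : HasDerivAt (fun s : ℝ => Real.exp (-s ^ 2 / 2)) (Real.exp (-s ^ 2 / 2) * (-s)) s := by
    have := ((hasDerivAt_id s).pow 2).neg.div_const 2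
    exact (this.congr_deriv (g' := -s) (by simp; ring)).exp
  exact ((h1.mul (KK_deriv s)).const_sub 1).congr_deriv (by rw [DD]; ring)

lemma KK3_cont : Continuous (KK 3) := by
  unfold KK
  refine continuous_of_dominated (bound := fun _ => 1)
    (fun s => (ch_cont0 3 s).aestronglyMeasurable)
    (fun s => ae_of_all _ fun g => cosh_inv_pow_bd 3 _) (integrable_const _)
    (ae_of_all _ fun g => ?_)
  simpa [mul_comm] using ch_cont0 3 g

lemma DD_cont : Continuous DD := by
  unfold DD
  exact (by fun_prop : Continuous fun s : ℝ => Real.exp (-s ^ 2 / 2)).mul KK3_cont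

lemma DD_zero : DD 0 = 1 := by simp [DD, KK]

lemma KK_pos (n : ℕ) (s : ℝ) : 0 < KK n s := by
  unfold KK
  rw [integral_pos_iff_support_of_nonneg (fun g => (pow_pos (cosh_inv_pos _) n).le) (KK_int n s)]
  have : Function.support (fun g : ℝ => (Real.cosh (s * g))⁻¹ ^ n) = Set.univ := by
    ext g; simp [(Real.cosh_pos (s * g)).ne']
  rw [this]; simp

lemma KK_anti {a b : ℝ} (ha : 0 ≤ a) (hab : a ≤ b) (n : ℕ) : KK n b ≤ KK n a := by
  refine integral_mono (KK_int n b) (KK_int n a) fun g => ?_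
  apply pow_le_pow_left₀ (cosh_inv_pos _).le
  apply inv_anti₀ (Real.cosh_pos _)
  rw [Real.cosh_le_cosh, abs_mul, abs_mul, abs_of_nonneg ha, abs_of_nonneg (ha.trans hab)]
  exact mul_le_mul_of_nonneg_right hab (abs_nonneg _)

lemma DD_anti {a b : ℝ} (ha : 0 ≤ a) (hab : a < b) : DD b < DD a := by
  unfold DD
  have h1 : Real.exp (-b ^ 2 / 2) < Real.exp (-a ^ 2 / 2) := Real.exp_lt_exp.2 (by nlinarith)
  exact mul_lt_mul h1 (KK_anti ha hab.le 3) (KK_pos 3 b) (Real.exp_pos _).le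

lemma SS_mvt {a b : ℝ} (hab : a < b) (ha : 0 ≤ a) :
    ∃ c ∈ Set.Ioo a b, SS b - SS a = (b ^ 2 - a ^ 2) * DD c := by
  obtain ⟨c, hc, h⟩ := exists_ratio_hasDerivAt_eq_ratio_slope SS (fun s => DD s * (2 * s)) hab
    (fun s _ => (SS_deriv s).continuousAt.continuousWithinAt) (fun s _ => SS_deriv s)
    (fun s => s ^ 2) (fun s => 2 * s) (by fun_prop)
    (fun s _ => by simpa using hasDerivAt_pow 2 s)
  refine ⟨c, hc, ?_⟩
  have : (2 * c) ≠ 0 := by have := hc.1; intro h; linarith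
  apply mul_right_cancel₀ this
  linarith

lemma SS_zero : SS 0 = 0 := by simp [SS, KK]

lemma SS_lt_one (s : ℝ) : SS s < 1 := by
  have := mul_pos (Real.exp_pos (-s ^ 2 / 2)) (KK_pos 1 s)
  unfold SS; linarith

lemma exists_fix (lam : ℝ) (hlam : 1 < lam) : ∃ s, 0 < s ∧ s < lam ∧ SS s = s ^ 2 / lam ^ 2 := by
  have hl2 : 1 / lam ^ 2 < DD 0 := by
    rw [DD_zero, div_lt_one (by positivity)]; nlinarith
  have hev : ∀ᶠ s in nhdsWithin (0 : ℝ) (Set.Ioi 0), 1 / lam ^ 2 < DD s :=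
    (DD_cont.continuousAt.eventually_const_lt hl2).filter_mono nhdsWithin_le_nhds
  have hev2 : ∀ᶠ s in nhdsWithin (0 : ℝ) (Set.Ioi 0), s < lam ∧ 0 < s :=
    Filter.Eventually.and
      ((eventually_lt_nhds (by linarith : (0 : ℝ) < lam)).filter_mono nhdsWithin_le_nhds)
      self_mem_nhdsWithin
  obtain ⟨a, ha, hal, ha0⟩ := (hev.and hev2).exists
  obtain ⟨c, hc, h⟩ := SS_mvt ha0 le_rfl
  rw [SS_zero, sub_zero] at h
  have h1 : a ^ 2 / lam ^ 2 < SS a := by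
    rw [h, div_eq_mul_one_div]
    have := DD_anti hc.1.le hc.2
    have h0 : (0 : ℝ) < a ^ 2 := by positivity
    have := mul_lt_mul_of_pos_left (ha.trans this) h0
    simpa using this
  have h2 : SS lam < lam ^ 2 / lam ^ 2 := by
    rw [div_self (by positivity)]; exact SS_lt_one _
  have hcont : Continuous SS := continuous_iff_continuousAt.2 fun s => (SS_deriv s).continuousAt
  obtain ⟨s, hs, he⟩ := intermediate_value_Ioo' (f := fun s => SS s - s ^ 2 / lam ^ 2) hal.le
    (by fun_prop) (show (0 : ℝ) ∈ _ from ⟨by linarith, by linarith⟩)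
  exact ⟨s, ha0.trans hs.1, hs.2, by simp only at he; linarith⟩

lemma DD_fix {lam s : ℝ} (hlam : 1 < lam) (hs : 0 < s) (h : SS s = s ^ 2 / lam ^ 2) :
    lam ^ 2 * DD s < 1 := by
  obtain ⟨c, hc, h'⟩ := SS_mvt hs le_rfl
  rw [SS_zero, sub_zero, h] at h'
  have hd := DD_anti hc.1.le hc.2
  have h3 : DD c = 1 / lam ^ 2 := by
    have : s ^ 2 ≠ 0 := by positivity
    apply mul_left_cancel₀ this
    rw [← div_eq_mul_one_div, h']; ring
  rw [h3, lt_div_iff₀ (by positivity)] at hd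
  linarith

lemma SS_above {lam s t : ℝ} (hlam : 1 < lam) (hs : 0 < s) (h : SS s = s ^ 2 / lam ^ 2)
    (hst : s < t) : SS t < t ^ 2 / lam ^ 2 := by
  obtain ⟨c, hc, h'⟩ := SS_mvt hst hs.le
  have hd := DD_anti hs.le hc.1
  have h1 := DD_fix hlam hs h
  have hl : 0 < lam ^ 2 := by positivity
  rw [lt_div_iff₀ hl]
  rw [eq_div_iff hl.ne'] at h
  have h2 : lam ^ 2 * DD c < 1 := (mul_lt_mul_of_pos_left hd hl).trans h1
  have h3 : 0 < t ^ 2 - s ^ 2 := by nlinarith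
  have h4 := mul_lt_mul_of_pos_left h2 h3
  have : SS t = SS s + (t ^ 2 - s ^ 2) * DD c := by linarith
  rw [this]
  nlinarith

lemma qOverlap_fix {lam s : ℝ} (hlam : 1 < lam) (hs : 0 < s) (hsl : s < lam)
    (h : SS s = s ^ 2 / lam ^ 2) : qOverlap lam (s ^ 2) = s ^ 2 / lam ^ 2 := by
  have hl0 : 0 < lam := by linarith
  have hsq : lam * √(s ^ 2 / lam ^ 2) = s := by
    rw [← div_pow, Real.sqrt_sq (by positivity)]; field_simp
  rw [qOverlap, if_neg (by positivity)]
  apply IsGreatest.csSup_eq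
  constructor
  · refine ⟨⟨by positivity, ?_⟩, ?_⟩
    · rw [← h]; exact (SS_lt_one s).le
    · rw [← h, ← tanh_sq_SS]
      congr 1; ext g
      rw [tanh_sq_SS, h, show lam * g * √(s ^ 2 / lam ^ 2) = (lam * √(s ^ 2 / lam ^ 2)) * g by ring,
        hsq]
  · rintro q ⟨⟨hq0, hq1⟩, hq⟩
    by_contra! hlt
    have hqs : √q ^ 2 = q := Real.sq_sqrt hq0.le
    have hsp : 0 < √q := Real.sqrt_pos.2 hq0
    have hst : s < lam * √q := by
      apply lt_of_pow_lt_pow_left₀ 2 (by positivity)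
      rw [div_lt_iff₀ (by positivity)] at hlt
      rw [mul_pow, hqs]; linarith
    have h1 := SS_above hlam hs h hst
    rw [mul_pow, hqs, mul_div_cancel_left₀ _ (by positivity), ← tanh_sq_SS] at h1
    have h2 := tanh_sq_mono (s := lam * √q) (by positivity) (sq_nonneg s)
      (pow_le_pow_left₀ hs.le hst.le 2)
    have e : ∀ g : ℝ, lam * g * √q = lam * √q * g := fun g => by ring
    simp only [e] at hq
    linarith

/-- For `λ > 1` and `β = λ`, there exists a fixed point `h > 0` of
`f_{λ,λ}` such that `(λ, λ²h)` satisfies the AT condition. -/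
theorem stmt17 (lam : ℝ) (hlam : 1 < lam) :
    ∃ h : ℝ, 0 < h ∧ fbl lam lam h = h ∧ ATCond lam (lam ^ 2 * h) := by
  obtain ⟨s, hs, hsl, h⟩ := exists_fix lam hlam
  have hl0 : 0 < lam := by linarith
  have hsq : lam * √(s ^ 2 / lam ^ 2) = s := by
    rw [← div_pow, Real.sqrt_sq (by positivity)]; field_simp
  have e1 : lam ^ 2 * (s ^ 2 / lam ^ 2) = s ^ 2 := by field_simp
  have e2 : ∀ g : ℝ, lam * g * √(s ^ 2 / lam ^ 2) = s * g := fun g => by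
    rw [mul_right_comm, hsq]
  refine ⟨s ^ 2 / lam ^ 2, by positivity, ?_, ?_⟩
  · rw [fbl, ← sq, e1, qOverlap_fix hlam hs hsl h]
    simp only [e2]
    rw [tanh_SS, h]
  · rw [ATCond, e1, qOverlap_fix hlam hs hsl h]
    simp only [e2, sech, one_div]
    rw [nish 3 s]
    exact DD_fix hlam hs h
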